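/- arXiv:1106.3840 — 2 statements merged into one kernel-verified Lean document; each statement's English description precedes it below -/
import Mathlib

section
/- Let G be a rectifiable space and let C be the connected component of G containing the right neutral element e. Then p(C × C) ⊆ C and q(C × C) ⊆ C; that is, C is stable under both operations p and q. -/
/-- In a rectifiable space `G`, the connected component `C` of the right
neutral element `e` is `p, q`-stable: `p(C × C) ⊆ C` and `q(C × C) ⊆ C`. -/
theorem rectifiable_component_stable
    {G : Type*} [TopologicalSpace G] (e : G) (p q : G × G → G)
    (hp : Continuous p) (hq : Continuous q)
    (hpq : ∀ x y : G, p (x, q (x, y)) = y)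
    (hqp : ∀ x y : G, q (x, p (x, y)) = y)
    (hqe : ∀ x : G, q (x, x) = e) :
    (∀ a ∈ connectedComponent e, ∀ b ∈ connectedComponent e,
        p (a, b) ∈ connectedComponent e) ∧
    (∀ a ∈ connectedComponent e, ∀ b ∈ connectedComponent e,
        q (a, b) ∈ connectedComponent e) := by
  have key : ∀ f : G × G → G, Continuous f → f (e, e) = e →
      ∀ a ∈ connectedComponent e, ∀ b ∈ connectedComponent e,
        f (a, b) ∈ connectedComponent e := by
    intro f hf he a ha b hb
    have hpre : IsPreconnected (f '' (connectedComponent e ×ˢ connectedComponent e)) :=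
      (isPreconnected_connectedComponent.prod isPreconnected_connectedComponent).image f
        hf.continuousOn
    exact hpre.subset_connectedComponent
      ⟨(e, e), ⟨mem_connectedComponent, mem_connectedComponent⟩, he⟩
      ⟨(a, b), ⟨ha, hb⟩, rfl⟩
  refine ⟨key p hp ?_, key q hq (hqe e)⟩
  have h := hpq e e
  rwa [hqe e] at h
end

section
/- Let Y be a pseudocompact Tychonoff space in which every point is a Gδ-point. Then Y is first-countable. -/
/-- A pseudocompact Tychonoff space in which every point is a Gδ-point is
first-countable. -/
theorem pseudocompact_Gdelta_points_first_countable
    {Y : Type*} [TopologicalSpace Y] [T35Space Y]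
    (hpc : ∀ f : Y → ℝ, Continuous f → ∃ M : ℝ, ∀ y : Y, |f y| ≤ M)
    (hGδ : ∀ y : Y, ∃ U : ℕ → Set Y, (∀ n, IsOpen (U n)) ∧
        (⋂ n, U n) = {y}) :
    FirstCountableTopology Y := by
  have cr : ∀ (y : Y) (V : Set Y), IsOpen V → y ∈ V → ∃ g : Y → ℝ, Continuous g ∧ g y = 0 ∧
      (∀ z, z ∉ V → g z = 1) ∧ (∀ z, 0 ≤ g z) ∧ ∀ z, g z ≤ 1 := by
    intro y V hV hy
    obtain ⟨f, hf, h0, h1⟩ := CompletelyRegularSpace.completely_regular y Vᶜ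
      hV.isClosed_compl (by simpa using hy)
    refine ⟨fun z => (f z : ℝ), by fun_prop, by simp [h0], fun z hz => ?_,
      fun z => (f z).2.1, fun z => (f z).2.2⟩
    have := h1 hz
    simp [this]
  refine ⟨fun y => ?_⟩
  obtain ⟨U, hU, hUy⟩ := hGδ y
  have hyU : ∀ n, y ∈ U n := fun n => by
    have : y ∈ ⋂ n, U n := by rw [hUy]; rfl
    exact Set.mem_iInter.1 this n
  choose g gc g0 g1 gnn gle using fun n => cr y (U n) (hU n) (hyU n)
  have hs : Summable fun n : ℕ => ((1 : ℝ) / 2) ^ n := summable_geometric_two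
  have hle : ∀ n z, ((1 : ℝ) / 2) ^ n * g n z ≤ (1 / 2) ^ n := fun n z =>
    mul_le_of_le_one_right (by positivity) (gle n z)
  have hnn : ∀ n z, 0 ≤ ((1 : ℝ) / 2) ^ n * g n z := fun n z =>
    mul_nonneg (by positivity) (gnn n z)
  obtain ⟨f, hf⟩ : ∃ f : Y → ℝ, f = fun z => ∑' n : ℕ, ((1 : ℝ) / 2) ^ n * g n z := ⟨_, rfl⟩
  have fc : Continuous f := by
    rw [hf]
    refine continuous_tsum (fun n => by have := gc n; fun_prop) hs fun n z => ?_
    rw [Real.norm_of_nonneg (hnn n z)]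
    exact hle n z
  have f0 : f y = 0 := by simp [hf, g0]
  have fpos : ∀ z, z ≠ y → 0 < f z := by
    intro z hz
    have : z ∉ ⋂ n, U n := by rw [hUy]; exact hz
    obtain ⟨n, hn⟩ : ∃ n, z ∉ U n := by simpa using this
    rw [hf]
    refine (Summable.of_nonneg_of_le (fun n => hnn n z) (fun n => hle n z) hs).tsum_pos
      (fun n => hnn n z) n ?_
    rw [g1 n z hn]
    positivity
  have key : nhds y = Filter.comap f (nhds 0) := by
    apply le_antisymm
    · rw [← f0]; exact fc.continuousAt.tendsto.le_comap
    · intro W hW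
      obtain ⟨V, hVW, hV, hyV⟩ := mem_nhds_iff.1 hW
      obtain ⟨h, hc, h0, h1, -, -⟩ := cr y V hV hyV
      have kc : Continuous fun z => max 0 (h z - 1 / 2) / f z := by
        rw [continuous_iff_continuousAt]
        intro z
        by_cases hz : z = y
        · subst hz
          have : ∀ᶠ w in nhds z, h w < 1 / 2 :=
            hc.continuousAt.eventually_lt_const (by rw [h0]; norm_num)
          refine (continuousAt_const (y := (0 : ℝ))).congr ?_
          filter_upwards [this] with w hw
          rw [max_eq_left (by linarith)]
          simp
        · exact ContinuousAt.div (by fun_prop) fc.continuousAt (fpos z hz).ne'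
      obtain ⟨M, hM⟩ := hpc _ kc
      have hM0 : 0 ≤ M := (abs_nonneg _).trans (hM y)
      refine ⟨Set.Iio (1 / (2 * (M + 1))), Iio_mem_nhds (by positivity), fun z hz => hVW ?_⟩
      by_contra hzV
      have hp := fpos z (by rintro rfl; exact hzV hyV)
      have h2 := (le_abs_self _).trans (hM z)
      simp only [h1 z hzV] at h2
      rw [max_eq_right (by norm_num), div_le_iff₀ hp] at h2
      have h3 : f z < 1 / (2 * (M + 1)) := hz
      rw [lt_div_iff₀ (by positivity)] at h3
      nlinarith
  rw [key]
  infer_instance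
end
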